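/- Second moment of the ratio: under the same hypotheses, E[ ((e_kᵀ R x)/(1 + xᵀ R x))² ] = c ∫₀^∞ p₂ |S|^{−1/2} exp(−p₂) exp(bᵀS⁻¹b/4) ( rᵀS⁻¹r/2 + (rᵀS⁻¹b)²/4 ) dp₂, where S = (1/2)Σ⁻¹ + p₂R, b = Σ⁻¹μ, c = 2^{−n/2}|Σ|^{−1/2} exp(−μᵀΣ⁻¹μ/2). -/

import Mathlib

open Matrix MeasureTheory Real

/-- Density of the multivariate normal distribution `N(μ, Σ)` on `ℝⁿ`. -/
noncomputable def gaussDensity {n : ℕ} (μv : Fin n → ℝ)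
    (Sig : Matrix (Fin n) (Fin n) ℝ) (x : Fin n → ℝ) : ℝ :=
  (2 * Real.pi) ^ (-(n : ℝ) / 2) * Sig.det ^ (-(1 : ℝ) / 2) *
    Real.exp (-((x - μv) ⬝ᵥ (Sig⁻¹).mulVec (x - μv)) / 2)


lemma aux_sq : ∫ t : ℝ, t ^ 2 * Real.exp (-t ^ 2) = √π / 2 := by
  have h1 := integral_comp_abs (f := fun t : ℝ => t ^ 2 * Real.exp (-t ^ 2))
  simp only [sq_abs] at h1
  rw [h1]
  have h2 := integral_rpow_mul_exp_neg_rpow (p := 2) (q := 2) (by norm_num) (by norm_num)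
  have h3 : Real.Gamma ((2 + 1) / 2) = √π / 2 := by
    rw [show ((2:ℝ) + 1) / 2 = 1 / 2 + 1 by norm_num, Real.Gamma_add_one (by norm_num),
      Real.Gamma_one_half_eq]; ring
  rw [h3] at h2
  simp only [Real.rpow_two] at h2
  rw [h2]; ring

lemma aux_one : ∫ t : ℝ, t * Real.exp (-t ^ 2) = 0 := by
  have h := integral_neg_eq_self (fun t : ℝ => t * Real.exp (-t ^ 2)) volume
  simp only [neg_sq, neg_mul, integral_neg] at h
  linarith

lemma aux_zero : ∫ t : ℝ, Real.exp (-t ^ 2) = √π := by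
  simpa using integral_gaussian 1

lemma auxi_sq : Integrable (fun t : ℝ => t ^ 2 * Real.exp (-t ^ 2)) := by
  simpa using integrable_rpow_mul_exp_neg_mul_sq one_pos (by norm_num : (-1 : ℝ) < 2)

lemma auxi_one : Integrable (fun t : ℝ => t * Real.exp (-t ^ 2)) := by
  simpa using integrable_mul_exp_neg_mul_sq one_pos

lemma auxi_zero : Integrable (fun t : ℝ => Real.exp (-t ^ 2)) := by
  simpa using integrable_exp_neg_mul_sq one_pos

lemma exp_dot {n : ℕ} (y : Fin n → ℝ) : Real.exp (-(y ⬝ᵥ y)) = ∏ l, Real.exp (-(y l) ^ 2) := by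
  rw [← Real.exp_sum, Finset.sum_neg_distrib]
  simp [dotProduct, sq]

lemma prod0 {n : ℕ} : Integrable (fun y : Fin n → ℝ => Real.exp (-(y ⬝ᵥ y))) ∧
    ∫ y : Fin n → ℝ, Real.exp (-(y ⬝ᵥ y)) = √π ^ n := by
  simp only [exp_dot]
  refine ⟨Integrable.fintype_prod (f := fun _ t => Real.exp (-t ^ 2)) fun _ => auxi_zero, ?_⟩
  rw [volume_pi, integral_fintype_prod_eq_prod (fun _ t => Real.exp (-t ^ 2))]
  simp [aux_zero]

lemma prod1 {n : ℕ} (i : Fin n) : Integrable (fun y : Fin n → ℝ => y i * Real.exp (-(y ⬝ᵥ y))) ∧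
    ∫ y : Fin n → ℝ, y i * Real.exp (-(y ⬝ᵥ y)) = 0 := by
  let f : Fin n → ℝ → ℝ := fun l t => (if l = i then t else 1) * Real.exp (-t ^ 2)
  have e : (fun y : Fin n → ℝ => y i * Real.exp (-(y ⬝ᵥ y))) = fun y => ∏ l, f l (y l) := by
    ext y; simp only [f, exp_dot, Finset.prod_mul_distrib, Finset.prod_ite_eq', Finset.mem_univ, if_true]
  rw [e]
  refine ⟨Integrable.fintype_prod fun l => ?_, ?_⟩
  · by_cases h : l = i
    · simpa [f, h] using auxi_one
    · simpa [f, h] using auxi_zero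
  rw [volume_pi, integral_fintype_prod_eq_prod]
  apply Finset.prod_eq_zero (Finset.mem_univ i)
  simpa [f] using aux_one

lemma prod2 {n : ℕ} (i j : Fin n) :
    Integrable (fun y : Fin n → ℝ => y i * y j * Real.exp (-(y ⬝ᵥ y))) ∧
    ∫ y : Fin n → ℝ, y i * y j * Real.exp (-(y ⬝ᵥ y)) = if i = j then √π ^ n / 2 else 0 := by
  let f : Fin n → ℝ → ℝ := fun l t => (if l = i then t else 1) * (if l = j then t else 1) *
    Real.exp (-t ^ 2)
  have e : (fun y : Fin n → ℝ => y i * y j * Real.exp (-(y ⬝ᵥ y))) = fun y => ∏ l, f l (y l) := by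
    ext y; simp only [f, exp_dot, Finset.prod_mul_distrib, Finset.prod_ite_eq', Finset.mem_univ, if_true]
  rw [e]
  refine ⟨Integrable.fintype_prod fun l => ?_, ?_⟩
  · by_cases h : l = i <;> by_cases h' : l = j
    · refine auxi_sq.congr (Filter.Eventually.of_forall fun t => ?_)
      simp only [f, if_pos h, if_pos h', sq]
    · refine auxi_one.congr (Filter.Eventually.of_forall fun t => ?_)
      simp only [f, if_pos h, if_neg h', mul_one]
    · refine auxi_one.congr (Filter.Eventually.of_forall fun t => ?_)
      simp only [f, if_pos h', if_neg h, one_mul]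
    · simpa [f, h, h'] using auxi_zero
  rw [volume_pi, integral_fintype_prod_eq_prod]
  split_ifs with h
  · subst h
    rw [← Finset.mul_prod_erase _ _ (Finset.mem_univ i)]
    have h1 : ∀ l ∈ Finset.univ.erase i, ∫ t, f l t = √π := by
      intro l hl
      simpa [f, Finset.ne_of_mem_erase hl] using aux_zero
    rw [Finset.prod_congr rfl h1]
    have h2 : ∫ t, f i t = √π / 2 := by simpa [f, ← sq] using aux_sq
    have hn : n = (n - 1) + 1 := by have := i.pos; omega
    rw [h2, Finset.prod_const, Finset.card_erase_of_mem (Finset.mem_univ i), Finset.card_univ,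
      Fintype.card_fin]
    conv_rhs => rw [hn, pow_succ]
    ring
  · apply Finset.prod_eq_zero (Finset.mem_univ i)
    simpa [f, h] using aux_one

/-- standard -/
lemma std2 {n : ℕ} (a : ℝ) (v : Fin n → ℝ) :
    Integrable (fun y : Fin n → ℝ => (a + v ⬝ᵥ y) ^ 2 * Real.exp (-(y ⬝ᵥ y))) ∧
    ∫ y : Fin n → ℝ, (a + v ⬝ᵥ y) ^ 2 * Real.exp (-(y ⬝ᵥ y)) =
      √π ^ n * (v ⬝ᵥ v / 2 + a ^ 2) := by
  have e : (fun y : Fin n → ℝ => (a + v ⬝ᵥ y) ^ 2 * Real.exp (-(y ⬝ᵥ y))) = fun y =>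
      a ^ 2 * Real.exp (-(y ⬝ᵥ y)) + (∑ i, 2 * a * v i * (y i * Real.exp (-(y ⬝ᵥ y))) +
        ∑ i, ∑ j, v i * v j * (y i * y j * Real.exp (-(y ⬝ᵥ y)))) := by
    ext y
    have h1 : ∑ i, 2 * a * v i * (y i * Real.exp (-(y ⬝ᵥ y))) =
        2 * a * (v ⬝ᵥ y) * Real.exp (-(y ⬝ᵥ y)) := by
      simp only [dotProduct, Finset.mul_sum, Finset.sum_mul]
      exact Finset.sum_congr rfl fun i _ => by ring
    have h2 : ∑ i, ∑ j, v i * v j * (y i * y j * Real.exp (-(y ⬝ᵥ y))) =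
        (v ⬝ᵥ y) * (v ⬝ᵥ y) * Real.exp (-(y ⬝ᵥ y)) := by
      generalize Real.exp (-(y ⬝ᵥ y)) = E
      simp only [dotProduct]
      rw [Finset.sum_mul_sum, Finset.sum_mul]
      simp only [Finset.sum_mul]
      exact Finset.sum_congr rfl fun i _ => Finset.sum_congr rfl fun j _ => by ring
    rw [h1, h2]; ring
  have i0 : Integrable (fun y : Fin n → ℝ => a ^ 2 * Real.exp (-(y ⬝ᵥ y))) := prod0.1.const_mul _
  have i1 : ∀ i, Integrable (fun y : Fin n → ℝ => 2 * a * v i * (y i * Real.exp (-(y ⬝ᵥ y)))) :=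
    fun i => (prod1 i).1.const_mul _
  have i2 : ∀ i j, Integrable (fun y : Fin n → ℝ =>
      v i * v j * (y i * y j * Real.exp (-(y ⬝ᵥ y)))) := fun i j => (prod2 i j).1.const_mul _
  have i1' := integrable_finsetSum Finset.univ fun i _ => i1 i
  have i2' : ∀ i, _ := fun i => integrable_finsetSum Finset.univ fun j _ => i2 i j
  have i2'' := integrable_finsetSum Finset.univ fun i _ => i2' i
  rw [e]
  refine ⟨i0.add (i1'.add i2''), ?_⟩
  rw [integral_add i0 (by exact i1'.add i2''), integral_add i1' i2'', integral_finsetSum _ fun i _ => i1 i,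
    integral_finsetSum _ fun i _ => i2' i]
  simp_rw [fun i => integral_finsetSum Finset.univ fun j _ => i2 i j, integral_const_mul,
    (prod1 _).2, (prod2 _ _).2, prod0.2]
  simp only [mul_zero, Finset.sum_const_zero, mul_ite, Finset.sum_ite_eq, Finset.mem_univ, if_true,
    ← Finset.sum_mul, dotProduct]
  ring

lemma gauss2 {n : ℕ} (S : Matrix (Fin n) (Fin n) ℝ) (hS : S.PosDef) (b r : Fin n → ℝ) :
    Integrable (fun x : Fin n → ℝ => (r ⬝ᵥ x) ^ 2 * Real.exp (-(x ⬝ᵥ S *ᵥ x) + b ⬝ᵥ x)) ∧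
    ∫ x : Fin n → ℝ, (r ⬝ᵥ x) ^ 2 * Real.exp (-(x ⬝ᵥ S *ᵥ x) + b ⬝ᵥ x) =
      √π ^ n * S.det ^ (-(1 : ℝ) / 2) * Real.exp ((b ⬝ᵥ S⁻¹ *ᵥ b) / 4) *
        ((r ⬝ᵥ S⁻¹ *ᵥ r) / 2 + (r ⬝ᵥ S⁻¹ *ᵥ b) ^ 2 / 4) := by
  have hdet := hS.det_pos
  have hT : Sᵀ = S := by simpa [IsHermitian, conjTranspose_eq_transpose_of_trivial] using hS.1
  obtain ⟨B, hB⟩ : ∃ B : Matrix (Fin n) (Fin n) ℝ, S = Bᵀ * B := by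
    open scoped MatrixOrder in
    obtain ⟨B, hB⟩ := CStarAlgebra.nonneg_iff_eq_star_mul_self.mp hS.posSemidef.nonneg
    exact ⟨B, by rw [hB, star_eq_conjTranspose, conjTranspose_eq_transpose_of_trivial]⟩
  have hd : S.det = B.det ^ 2 := by rw [hB, det_mul, det_transpose, sq]
  have hB0 : B.det ≠ 0 := by intro h; rw [hd, h] at hdet; simp at hdet
  have hBu : IsUnit B.det := hB0.isUnit
  have hSu : IsUnit S.det := hdet.ne'.isUnit
  set m : Fin n → ℝ := (1 / 2 : ℝ) • S⁻¹ *ᵥ b with hm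
  have hSm : S *ᵥ m = (1 / 2 : ℝ) • b := by
    rw [hm, mulVec_smul, mulVec_mulVec, mul_nonsing_inv _ hSu, one_mulVec]
  set K : ℝ := Real.exp ((b ⬝ᵥ S⁻¹ *ᵥ b) / 4) with hK
  set v : Fin n → ℝ := (B⁻¹)ᵀ *ᵥ r with hv
  set a : ℝ := r ⬝ᵥ m with ha
  have hvx : ∀ x, v ⬝ᵥ B *ᵥ x = r ⬝ᵥ x := by
    intro x
    rw [hv, mulVec_transpose, ← dotProduct_mulVec, mulVec_mulVec, nonsing_inv_mul _ hBu, one_mulVec]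
  have hvv : v ⬝ᵥ v = r ⬝ᵥ S⁻¹ *ᵥ r := by
    rw [hB, Matrix.mul_inv_rev, ← mulVec_mulVec, ← transpose_nonsing_inv,
      dotProduct_mulVec r, ← mulVec_transpose]
  have hxx : ∀ x, B *ᵥ x ⬝ᵥ B *ᵥ x = x ⬝ᵥ S *ᵥ x := by
    intro x
    rw [hB, ← mulVec_mulVec, dotProduct_mulVec x, vecMul_transpose]
  have key : ∀ x, (r ⬝ᵥ (x + m)) ^ 2 * Real.exp (-((x + m) ⬝ᵥ S *ᵥ (x + m)) + b ⬝ᵥ (x + m)) =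
      K * ((a + v ⬝ᵥ B *ᵥ x) ^ 2 * Real.exp (-(B *ᵥ x ⬝ᵥ B *ᵥ x))) := by
    intro x
    have e1 : m ⬝ᵥ S *ᵥ x = (1 / 2 : ℝ) * (b ⬝ᵥ x) := by
      rw [dotProduct_mulVec, ← mulVec_transpose, hT, hSm, smul_dotProduct, smul_eq_mul]
    have e2 : b ⬝ᵥ m = (1 / 2 : ℝ) * (b ⬝ᵥ S⁻¹ *ᵥ b) := by
      rw [hm, dotProduct_smul, smul_eq_mul]
    have e3 : -((x + m) ⬝ᵥ S *ᵥ (x + m)) + b ⬝ᵥ (x + m) =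
        (b ⬝ᵥ S⁻¹ *ᵥ b) / 4 + -(x ⬝ᵥ S *ᵥ x) := by
      rw [mulVec_add, add_dotProduct, dotProduct_add, dotProduct_add, dotProduct_add, e1, hSm,
        dotProduct_smul, dotProduct_smul, smul_eq_mul, smul_eq_mul, dotProduct_comm m b, e2,
        dotProduct_comm x b]
      ring
    rw [e3, Real.exp_add, hvx, hxx, dotProduct_add]
    ring
  obtain ⟨hi, hI⟩ := std2 a v
  have hi' := hi.const_mul K
  have hmap := Real.map_matrix_volume_pi_eq_smul_volume_pi hB0
  have hmeas : Measurable (toLin' B) := (LinearMap.continuous_of_finiteDimensional _).measurable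
  have hi'' : Integrable (fun y : Fin n → ℝ => K * ((a + v ⬝ᵥ y) ^ 2 * Real.exp (-(y ⬝ᵥ y))))
      (Measure.map (toLin' B) volume) := by
    rw [hmap]
    exact hi'.smul_measure (by simp)
  have habs : |B.det⁻¹| = S.det ^ (-(1 : ℝ) / 2) := by
    rw [hd, neg_div, Real.rpow_neg (sq_nonneg _), ← Real.sqrt_eq_rpow, Real.sqrt_sq_eq_abs, abs_inv]
  constructor
  · have := hi''.comp_measurable hmeas
    have h2 : Integrable (fun x => (r ⬝ᵥ (x + m)) ^ 2 *
        Real.exp (-((x + m) ⬝ᵥ S *ᵥ (x + m)) + b ⬝ᵥ (x + m))) := by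
      refine this.congr (Filter.Eventually.of_forall fun x => ?_)
      exact (key x).symm
    have h3 := h2.comp_sub_right m
    simpa using h3
  · rw [← integral_add_right_eq_self _ m]
    simp_rw [key]
    have h1 := integral_map (φ := toLin' B) hmeas.aemeasurable hi''.1
    simp only [toLin'_apply] at h1
    rw [← h1, hmap, integral_smul_measure, integral_const_mul, hI, hvv, ENNReal.toReal_ofReal
      (abs_nonneg _), habs, smul_eq_mul]
    have : a = (r ⬝ᵥ S⁻¹ *ᵥ b) / 2 := by
      rw [ha, hm, dotProduct_smul, smul_eq_mul]; ring
    rw [this]; ring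

/-- Second moment of the ratio for `x ~ N(μ, Σ)`:
`E[((e_kᵀRx)/(1 + xᵀRx))²]
  = c ∫₀^∞ p₂ |S|^{−1/2} e^{−p₂} e^{bᵀS⁻¹b/4} (rᵀS⁻¹r/2 + (rᵀS⁻¹b)²/4) dp₂`. -/
theorem second_moment_ratio {n : ℕ} (μv : Fin n → ℝ)
    (Sig R : Matrix (Fin n) (Fin n) ℝ) (hSig : Sig.PosDef) (hR : R.PosDef)
    (hRsymm : Rᵀ = R) (k : Fin n)
    (b : Fin n → ℝ) (hb : b = (Sig⁻¹).mulVec μv)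
    (r : Fin n → ℝ) (hr : r = fun i => R i k)
    (c : ℝ) (hc : c = (2 : ℝ) ^ (-(n : ℝ) / 2) * Sig.det ^ (-(1 : ℝ) / 2) *
      Real.exp (-(μv ⬝ᵥ (Sig⁻¹).mulVec μv) / 2)) :
    ∫ x : Fin n → ℝ,
        ((Pi.single k 1 ⬝ᵥ R.mulVec x) / (1 + x ⬝ᵥ R.mulVec x)) ^ 2 *
          gaussDensity μv Sig x =
      c * ∫ p₂ in Set.Ioi (0 : ℝ),
        p₂ * ((1 / 2 : ℝ) • Sig⁻¹ + p₂ • R).det ^ (-(1 : ℝ) / 2) * Real.exp (-p₂) *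
          Real.exp ((b ⬝ᵥ (((1 / 2 : ℝ) • Sig⁻¹ + p₂ • R)⁻¹).mulVec b) / 4) *
          ((r ⬝ᵥ (((1 / 2 : ℝ) • Sig⁻¹ + p₂ • R)⁻¹).mulVec r) / 2 +
            (r ⬝ᵥ (((1 / 2 : ℝ) • Sig⁻¹ + p₂ • R)⁻¹).mulVec b) ^ 2 / 4) := by
  have hT : (Sig⁻¹)ᵀ = Sig⁻¹ := by
    simpa [IsHermitian, conjTranspose_eq_transpose_of_trivial] using hSig.inv.1
  set C : ℝ := (2 * Real.pi) ^ (-(n : ℝ) / 2) * Sig.det ^ (-(1 : ℝ) / 2) *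
    Real.exp (-(μv ⬝ᵥ (Sig⁻¹).mulVec μv) / 2) with hC
  have hq : ∀ x, 0 ≤ x ⬝ᵥ R.mulVec x := fun x => by
    simpa using hR.posSemidef.dotProduct_mulVec_nonneg x
  have hrx : ∀ x, Pi.single k 1 ⬝ᵥ R.mulVec x = r ⬝ᵥ x := by
    intro x
    rw [single_one_dotProduct, hr]
    simp only [mulVec]
    congr 1
    ext i
    conv_lhs => rw [← hRsymm]
    rfl
  have hg : ∀ (p : ℝ) x, Real.exp (-(p * (x ⬝ᵥ R.mulVec x))) * gaussDensity μv Sig x =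
      C * Real.exp (-(x ⬝ᵥ ((1 / 2 : ℝ) • Sig⁻¹ + p • R).mulVec x) + b ⬝ᵥ x) := by
    intro p x
    have e1 : μv ⬝ᵥ Sig⁻¹ *ᵥ x = b ⬝ᵥ x := by
      rw [dotProduct_mulVec, ← mulVec_transpose, hT, hb]
    have e2 : -((x - μv) ⬝ᵥ (Sig⁻¹).mulVec (x - μv)) / 2 =
        -(μv ⬝ᵥ (Sig⁻¹).mulVec μv) / 2 + (-(x ⬝ᵥ Sig⁻¹ *ᵥ x) / 2 + b ⬝ᵥ x) := by
      rw [mulVec_sub, sub_dotProduct, dotProduct_sub, dotProduct_sub, e1, ← hb,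
        dotProduct_comm x b]
      ring
    have e3 : -(x ⬝ᵥ ((1 / 2 : ℝ) • Sig⁻¹ + p • R).mulVec x) + b ⬝ᵥ x =
        -(p * (x ⬝ᵥ R.mulVec x)) + (-(x ⬝ᵥ Sig⁻¹ *ᵥ x) / 2 + b ⬝ᵥ x) := by
      rw [add_mulVec, smul_mulVec, smul_mulVec, dotProduct_add, dotProduct_smul,
        dotProduct_smul, smul_eq_mul, smul_eq_mul]
      ring
    rw [gaussDensity, e2, e3, Real.exp_add, Real.exp_add (-(p * _)), hC]
    ring
  have hS : ∀ p : ℝ, 0 ≤ p → ((1 / 2 : ℝ) • Sig⁻¹ + p • R).PosDef := fun p hp =>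
    (hSig.inv.smul (by norm_num : (0 : ℝ) < 1 / 2)).add_posSemidef (hR.posSemidef.smul hp)
  have hgi : Integrable fun x => (r ⬝ᵥ x) ^ 2 * gaussDensity μv Sig x := by
    refine ((gauss2 _ (hS 0 le_rfl) b r).1.const_mul C).congr (Filter.Eventually.of_forall fun x => ?_)
    have := hg 0 x
    rw [zero_mul, neg_zero, Real.exp_zero, one_mul] at this
    simp only [this]
    ring
  have hgpos : ∀ x, 0 ≤ gaussDensity μv Sig x := by
    intro x
    have := hSig.det_pos
    unfold gaussDensity
    positivity
  have hgc : Continuous (gaussDensity μv Sig) := by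
    unfold gaussDensity
    fun_prop
  have hi1 : ∀ x, IntegrableOn (fun p : ℝ => p * Real.exp (-((1 + x ⬝ᵥ R.mulVec x) * p)))
      (Set.Ioi 0) := by
    intro x
    have := integrableOn_rpow_mul_exp_neg_mul_rpow (p := 1) (s := 1)
      (b := 1 + x ⬝ᵥ R.mulVec x) (by norm_num) one_pos (by linarith [hq x])
    simpa only [Real.rpow_one, neg_mul] using this
  have hI1 : ∀ x, ∫ p in Set.Ioi (0 : ℝ), p * Real.exp (-((1 + x ⬝ᵥ R.mulVec x) * p)) =
      (1 / (1 + x ⬝ᵥ R.mulVec x)) ^ 2 := by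
    intro x
    have := Real.integral_rpow_mul_exp_neg_mul_Ioi (a := 2)
      (r := 1 + x ⬝ᵥ R.mulVec x) two_pos (by linarith [hq x])
    rw [Real.Gamma_two, mul_one, Real.rpow_two] at this
    rw [← this]
    norm_num
  let F : (Fin n → ℝ) → ℝ → ℝ := fun x p =>
    ((r ⬝ᵥ x) ^ 2 * gaussDensity μv Sig x) * (p * Real.exp (-((1 + x ⬝ᵥ R.mulVec x) * p)))
  have hFI : ∀ x, ∫ p in Set.Ioi (0 : ℝ), F x p =
      ((Pi.single k 1 ⬝ᵥ R.mulVec x) / (1 + x ⬝ᵥ R.mulVec x)) ^ 2 * gaussDensity μv Sig x := by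
    intro x
    simp only [F]
    rw [integral_const_mul, hI1, hrx]
    ring
  have hFint : Integrable (Function.uncurry F) (volume.prod (volume.restrict (Set.Ioi (0 : ℝ)))) := by
    have hFc : Continuous (Function.uncurry F) := by
      simp only [F, Function.uncurry_def]
      fun_prop
    rw [integrable_prod_iff hFc.aestronglyMeasurable]
    refine ⟨Filter.Eventually.of_forall fun x => (hi1 x).const_mul ((r ⬝ᵥ x) ^ 2 * gaussDensity μv Sig x), ?_⟩
    have hn : ∀ x, ∫ p in Set.Ioi (0 : ℝ), ‖Function.uncurry F (x, p)‖ =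
        ((r ⬝ᵥ x) ^ 2 * gaussDensity μv Sig x) * (1 / (1 + x ⬝ᵥ R.mulVec x)) ^ 2 := by
      intro x
      rw [← hI1, ← integral_const_mul]
      refine setIntegral_congr_fun measurableSet_Ioi fun p hp => ?_
      have hp' : (0 : ℝ) < p := hp
      have := hgpos x
      simp only [Function.uncurry_apply_pair, F]
      exact Real.norm_of_nonneg (by positivity)
    simp_rw [hn]
    refine hgi.mono' ?_ (Filter.Eventually.of_forall fun x => ?_)
    · apply Measurable.aestronglyMeasurable
      have h1 : Measurable fun x : Fin n → ℝ => x ⬝ᵥ R.mulVec x :=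
        Continuous.measurable (by fun_prop)
      have h2 : Measurable fun x : Fin n → ℝ => r ⬝ᵥ x :=
        Continuous.measurable (by fun_prop)
      have h3 := hgc.measurable
      fun_prop
    · have h1 := hgpos x
      have h2 := hq x
      rw [Real.norm_of_nonneg (by positivity)]
      refine mul_le_of_le_one_right (by positivity) (pow_le_one₀ (by positivity) ?_)
      rw [div_le_one (by linarith)]
      linarith
  simp_rw [← hFI]
  rw [integral_integral_swap hFint, ← integral_const_mul]
  refine setIntegral_congr_fun measurableSet_Ioi fun p hp => ?_
  have hp' : (0 : ℝ) < p := hp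
  have hF : ∀ x, F x p = (p * Real.exp (-p) * C) * ((r ⬝ᵥ x) ^ 2 *
      Real.exp (-(x ⬝ᵥ ((1 / 2 : ℝ) • Sig⁻¹ + p • R).mulVec x) + b ⬝ᵥ x)) := by
    intro x
    have h := hg p x
    have e : -((1 + x ⬝ᵥ R.mulVec x) * p) = -p + -(p * (x ⬝ᵥ R.mulVec x)) := by ring
    simp only [F]
    rw [e, Real.exp_add]
    linear_combination ((r ⬝ᵥ x) ^ 2 * p * Real.exp (-p)) * h
  have hconst : C * √π ^ n = c := by
    have : (2 * Real.pi) ^ (-(n : ℝ) / 2) * √π ^ n = (2 : ℝ) ^ (-(n : ℝ) / 2) := by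
      rw [Real.mul_rpow (by norm_num) pi_pos.le, mul_assoc, Real.sqrt_eq_rpow, ← Real.rpow_natCast,
        ← Real.rpow_mul pi_pos.le, ← Real.rpow_add pi_pos]
      have : -(n : ℝ) / 2 + 1 / 2 * n = 0 := by ring
      rw [this, Real.rpow_zero, mul_one]
    rw [hC, hc, ← this]
    ring
  simp_rw [hF]
  rw [integral_const_mul, (gauss2 _ (hS p hp'.le) b r).2, ← hconst]
  ring
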